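/- Let β ∈ ℝ, let μ and ν be Borel probability measures on ℝ with finite fourth moments, set m_μ := ∫ u dμ(u) and m_ν := ∫ u dν(u), and let π be a coupling of μ and ν. Then ∫_{ℝ×ℝ} [ 2(x − y)·( (−x³ − 2(x + β·m_μ)) − (−y³ − 2(y + β·m_ν)) ) + ( (x + β·m_μ) − (y + β·m_ν) )² ] dπ(x, y) ≤ (−2 + 2β²)·∫_{ℝ×ℝ} (x − y)² dπ(x, y). -/

import Mathlib

open MeasureTheory

/-- The square of a Bochner integral against a probability measure is at most the integral of the
square. -/
lemma sq_integral_le_integral_sq {Ω : Type*} [MeasurableSpace Ω] {P : Measure Ω}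
    [IsProbabilityMeasure P] {f : Ω → ℝ} (hf : Integrable f P)
    (hf2 : Integrable (fun ω => f ω ^ 2) P) : (∫ ω, f ω ∂P) ^ 2 ≤ ∫ ω, f ω ^ 2 ∂P := by
  set a := ∫ ω, f ω ∂P with ha
  have hle : ∫ ω, (2 * a * f ω - a ^ 2) ∂P ≤ ∫ ω, f ω ^ 2 ∂P :=
    integral_mono ((hf.const_mul _).sub (integrable_const _)) hf2
      fun ω => by nlinarith [sq_nonneg (f ω - a)]
  rw [integral_sub (hf.const_mul _) (integrable_const _), integral_const_mul, ← ha,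
    integral_const, probReal_univ, one_smul] at hle
  linarith

/-- A continuous function with at most quartic growth is integrable against a finite measure on the
plane with finite fourth moments. -/
lemma integrable_of_abs_le_quartic {P : Measure (ℝ × ℝ)} [IsFiniteMeasure P]
    (h₁ : Integrable (fun p : ℝ × ℝ => p.1 ^ 4) P) (h₂ : Integrable (fun p : ℝ × ℝ => p.2 ^ 4) P)
    {f : ℝ × ℝ → ℝ} (hf : Continuous f) (C : ℝ)
    (hC : ∀ p, |f p| ≤ C * (1 + p.1 ^ 4 + p.2 ^ 4)) : Integrable f P :=
  ((((integrable_const 1).add h₁).add h₂).const_mul C).mono' hf.aestronglyMeasurable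
    (Filter.Eventually.of_forall hC)

/-- Dissipativity estimate of Example 5.1(ii), state i = 1: the coupled generator
applied to Ṽ(z) = z² integrates to at most (−2 + 2β²) times the coupled second
moment. -/
theorem example51_dissipativity
    (β : ℝ) (μ ν : Measure ℝ) [IsProbabilityMeasure μ] [IsProbabilityMeasure ν]
    (hμ4 : Integrable (fun u : ℝ => u ^ 4) μ)
    (hν4 : Integrable (fun u : ℝ => u ^ 4) ν)
    (π : Measure (ℝ × ℝ)) [IsProbabilityMeasure π]
    (hπ1 : π.map Prod.fst = μ) (hπ2 : π.map Prod.snd = ν) :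
    (∫ p : ℝ × ℝ,
        (2 * (p.1 - p.2) *
          ((-p.1 ^ 3 - 2 * (p.1 + β * ∫ u, u ∂μ)) -
            (-p.2 ^ 3 - 2 * (p.2 + β * ∫ u, u ∂ν))) +
          ((p.1 + β * ∫ u, u ∂μ) - (p.2 + β * ∫ u, u ∂ν)) ^ 2) ∂π) ≤
      (-2 + 2 * β ^ 2) * ∫ p : ℝ × ℝ, (p.1 - p.2) ^ 2 ∂π := by
  have h₁ : Integrable (fun p : ℝ × ℝ => p.1 ^ 4) π := by
    rw [← hπ1] at hμ4
    exact hμ4.comp_measurable measurable_fst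
  have h₂ : Integrable (fun p : ℝ × ℝ => p.2 ^ 4) π := by
    rw [← hπ2] at hν4
    exact hν4.comp_measurable measurable_snd
  have hx : Integrable (fun p : ℝ × ℝ => p.1) π :=
    integrable_of_abs_le_quartic h₁ h₂ (by fun_prop) 1 fun p => by
      rw [abs_le]
      constructor <;>
        nlinarith [sq_nonneg (p.1 ^ 2 - 1), sq_nonneg (p.1 - 1), sq_nonneg (p.1 + 1),
          sq_nonneg (p.2 ^ 2)]
  have hy : Integrable (fun p : ℝ × ℝ => p.2) π :=
    integrable_of_abs_le_quartic h₁ h₂ (by fun_prop) 1 fun p => by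
      rw [abs_le]
      constructor <;>
        nlinarith [sq_nonneg (p.2 ^ 2 - 1), sq_nonneg (p.2 - 1), sq_nonneg (p.2 + 1),
          sq_nonneg (p.1 ^ 2)]
  have hd : Integrable (fun p : ℝ × ℝ => p.1 - p.2) π := hx.sub hy
  have hd2 : Integrable (fun p : ℝ × ℝ => (p.1 - p.2) ^ 2) π :=
    integrable_of_abs_le_quartic h₁ h₂ (by fun_prop) 2 fun p => by
      rw [abs_of_nonneg (sq_nonneg _)]
      nlinarith [sq_nonneg (p.1 ^ 2 - 1), sq_nonneg (p.2 ^ 2 - 1), sq_nonneg (p.1 + p.2),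
        sq_nonneg (p.1 ^ 2), sq_nonneg (p.2 ^ 2)]
  have hcubic : Integrable (fun p : ℝ × ℝ => (p.1 - p.2) * (p.1 ^ 3 - p.2 ^ 3)) π :=
    integrable_of_abs_le_quartic h₁ h₂ (by fun_prop) 2 fun p => by
      have hfac : (p.1 - p.2) * (p.1 ^ 3 - p.2 ^ 3) =
          (p.1 - p.2) ^ 2 * (p.1 ^ 2 + p.1 * p.2 + p.2 ^ 2) := by ring
      rw [abs_of_nonneg]
      · nlinarith [mul_nonneg (sq_nonneg (p.1 + p.2))
          (by nlinarith [sq_nonneg (p.1 - p.2), sq_nonneg (p.1 + p.2)] :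
            0 ≤ p.1 ^ 2 - p.1 * p.2 + p.2 ^ 2)]
      · rw [hfac]
        exact mul_nonneg (sq_nonneg _)
          (by nlinarith [sq_nonneg (p.1 - p.2), sq_nonneg (p.1 + p.2)])
  have hmean : (∫ u, u ∂μ) - ∫ u, u ∂ν = ∫ p : ℝ × ℝ, (p.1 - p.2) ∂π := by
    rw [integral_sub hx hy, ← hπ1, ← hπ2, integral_map measurable_fst.aemeasurable (by fun_prop),
      integral_map measurable_snd.aemeasurable (by fun_prop)]
  have hsq := sq_integral_le_integral_sq hd hd2
  rw [← hmean] at hsq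
  generalize (∫ u, u ∂μ) = m at hsq ⊢
  generalize (∫ u, u ∂ν) = n at hsq ⊢
  have hle : ∀ p : ℝ × ℝ,
      2 * (p.1 - p.2) * ((-p.1 ^ 3 - 2 * (p.1 + β * m)) - (-p.2 ^ 3 - 2 * (p.2 + β * n))) +
          ((p.1 + β * m) - (p.2 + β * n)) ^ 2 ≤
        -2 * (p.1 - p.2) ^ 2 + 2 * β ^ 2 * (m - n) ^ 2 := fun p => by
    nlinarith [sq_nonneg (p.1 - p.2 + β * (m - n)),
      mul_nonneg (sq_nonneg (p.1 - p.2))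
        (by nlinarith [sq_nonneg (p.1 - p.2), sq_nonneg (p.1 + p.2)] :
          0 ≤ p.1 ^ 2 + p.1 * p.2 + p.2 ^ 2)]
  have hint : Integrable (fun p : ℝ × ℝ =>
      2 * (p.1 - p.2) * ((-p.1 ^ 3 - 2 * (p.1 + β * m)) - (-p.2 ^ 3 - 2 * (p.2 + β * n))) +
        ((p.1 + β * m) - (p.2 + β * n)) ^ 2) π := by
    refine ((((hcubic.const_mul (-2)).add (hd2.const_mul (-3))).add
      (hd.const_mul (-2 * β * (m - n)))).add
        (integrable_const (β ^ 2 * (m - n) ^ 2))).congr (.of_forall fun p => ?_)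
    simp only [Pi.add_apply]
    ring
  refine (integral_mono hint ((hd2.const_mul _).add (integrable_const _)) hle).trans ?_
  simp only [Pi.add_apply]
  rw [integral_add (hd2.const_mul _) (integrable_const _), integral_const_mul, integral_const,
    probReal_univ, one_smul]
  nlinarith [mul_le_mul_of_nonneg_left hsq (sq_nonneg β)]
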